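/- arXiv:2403.00748 — 10 statements merged into one kernel-verified Lean document; each statement's English description precedes it below -/
import Mathlib

section
/- Let Q be an n×n real symmetric positive definite matrix, A a k×n real matrix of full row rank k, l ∈ ℝⁿ and d ∈ ℝᵏ. If (Δx, Δλ) ∈ ℝⁿ × ℝᵏ satisfies the Newton-KKT system Q·Δx + Aᵀ·Δλ = −l and A·Δx = −d, then Δx is the unique global minimizer of the quadratic function p ↦ ½ pᵀQp + lᵀp over the affine set {p ∈ ℝⁿ : A p + d = 0}. -/
open Matrix

/-- If `(Δx, Δλ)` solves the Newton-KKT system `Q Δx + Aᵀ Δλ = -l`, `A Δx = -d`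
with `Q` symmetric positive definite and `A` of full row rank, then `Δx` is the
unique global minimizer of `p ↦ ½ pᵀQp + lᵀp` over `{p : A p + d = 0}`. -/
theorem kkt_solution_is_unique_minimizer {n k : ℕ}
    (Q : Matrix (Fin n) (Fin n) ℝ) (A : Matrix (Fin k) (Fin n) ℝ)
    (l : Fin n → ℝ) (d : Fin k → ℝ)
    (hQ : Q.PosDef) (hA : LinearIndependent ℝ (fun i => A i))
    (Δx : Fin n → ℝ) (Δl : Fin k → ℝ)
    (h1 : Q.mulVec Δx + Aᵀ.mulVec Δl = -l)
    (h2 : A.mulVec Δx = -d) :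
    A.mulVec Δx + d = 0 ∧
    ∀ p : Fin n → ℝ, A.mulVec p + d = 0 → p ≠ Δx →
      (1 / 2) * (Δx ⬝ᵥ Q.mulVec Δx) + l ⬝ᵥ Δx <
        (1 / 2) * (p ⬝ᵥ Q.mulVec p) + l ⬝ᵥ p := by
  refine ⟨by rw [h2]; simp, ?_⟩
  intro p hp hne
  obtain ⟨v, rfl⟩ : ∃ v, p = Δx + v := ⟨p - Δx, by simp⟩
  have hv : v ≠ 0 := by
    rintro rfl
    simp at hne
  have hAv : A.mulVec v = 0 := by
    rw [Matrix.mulVec_add, h2] at hp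
    simpa using hp
  have hpos : 0 < v ⬝ᵥ Q.mulVec v := by
    simpa using hQ.dotProduct_mulVec_pos hv
  have hQt : Qᵀ = Q := by
    simpa [Matrix.IsHermitian, Matrix.conjTranspose_eq_transpose_of_trivial] using hQ.isHermitian
  have hsym : Δx ⬝ᵥ Q.mulVec v = v ⬝ᵥ Q.mulVec Δx := by
    rw [Matrix.dotProduct_mulVec, ← Matrix.mulVec_transpose, hQt, dotProduct_comm]
  have hl : v ⬝ᵥ Aᵀ.mulVec Δl = 0 := by
    rw [Matrix.dotProduct_mulVec, Matrix.vecMul_transpose, hAv, zero_dotProduct]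
  have h3 : v ⬝ᵥ Q.mulVec Δx = - (l ⬝ᵥ v) := by
    have h4 := congrArg (fun w => v ⬝ᵥ w) h1
    simp only [dotProduct_add, dotProduct_neg, hl, add_zero] at h4
    rw [h4, dotProduct_comm]
  simp only [Matrix.mulVec_add, dotProduct_add, add_dotProduct]
  linarith
end

section
/- Let g : ℝⁿ → ℝ and c : ℝⁿ → ℝᵏ be differentiable at x, let λ ∈ ℝᵏ, ρ ≥ 0, and set A = Dc(x), d = c(x), l = ∇g(x) + Aᵀλ. Suppose Δx ∈ ℝⁿ, Δλ ∈ ℝᵏ and a symmetric matrix Q ∈ ℝ^{n×n} satisfy Q·Δx + Aᵀ·Δλ = −l and A·Δx = −d. Then the directional derivative of the merit function m_ρ at (x, λ) in the direction (Δx, 0) equals −ΔxᵀQΔx + dᵀΔλ − ρ‖d‖². -/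
open Matrix

/-- Directional derivative of the ℓ₂ augmented Lagrangian merit function
`m_ρ(x, λ) = g x + λᵀ c x + (ρ/2)‖c x‖²` in the direction `(Δx, 0)`:
it equals `-ΔxᵀQΔx + dᵀΔλ - ρ‖d‖²` whenever `(Δx, Δλ)` solves the SQP
Newton-KKT system. -/
theorem merit_directional_derivative_primal {n k : ℕ}
    (g : (Fin n → ℝ) → ℝ) (c : (Fin n → ℝ) → Fin k → ℝ)
    (x : Fin n → ℝ) (lam : Fin k → ℝ) (ρ : ℝ) (hρ : 0 ≤ ρ)
    (g' : (Fin n → ℝ) →L[ℝ] ℝ) (c' : (Fin n → ℝ) →L[ℝ] (Fin k → ℝ))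
    (hg : HasFDerivAt g g' x) (hc : HasFDerivAt c c' x)
    (gradg : Fin n → ℝ) (hgrad : ∀ v, g' v = gradg ⬝ᵥ v)
    (A : Matrix (Fin k) (Fin n) ℝ) (hA : ∀ v, c' v = A.mulVec v)
    (d : Fin k → ℝ) (hd : d = c x)
    (l : Fin n → ℝ) (hl : l = gradg + Aᵀ.mulVec lam)
    (Q : Matrix (Fin n) (Fin n) ℝ) (hQ : Q.IsSymm)
    (Δx : Fin n → ℝ) (Δl : Fin k → ℝ)
    (h1 : Q.mulVec Δx + Aᵀ.mulVec Δl = -l)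
    (h2 : A.mulVec Δx = -d) :
    fderiv ℝ
        (fun p : (Fin n → ℝ) × (Fin k → ℝ) =>
          g p.1 + p.2 ⬝ᵥ c p.1 + ρ / 2 * (c p.1 ⬝ᵥ c p.1)) (x, lam)
        (Δx, 0)
      = -(Δx ⬝ᵥ Q.mulVec Δx) + d ⬝ᵥ Δl - ρ * (d ⬝ᵥ d) := by
  have hfst : HasFDerivAt (fun p : (Fin n → ℝ) × (Fin k → ℝ) => p.1)
      (ContinuousLinearMap.fst ℝ (Fin n → ℝ) (Fin k → ℝ)) (x, lam) := hasFDerivAt_fst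
  have hsnd : HasFDerivAt (fun p : (Fin n → ℝ) × (Fin k → ℝ) => p.2)
      (ContinuousLinearMap.snd ℝ (Fin n → ℝ) (Fin k → ℝ)) (x, lam) := hasFDerivAt_snd
  have hG : HasFDerivAt (fun p : (Fin n → ℝ) × (Fin k → ℝ) => g p.1)
      (g'.comp (ContinuousLinearMap.fst ℝ (Fin n → ℝ) (Fin k → ℝ))) (x, lam) :=
    HasFDerivAt.comp (x, lam) (f := fun p : (Fin n → ℝ) × (Fin k → ℝ) => p.1) hg hfst
  have hC : HasFDerivAt (fun p : (Fin n → ℝ) × (Fin k → ℝ) => c p.1)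
      (c'.comp (ContinuousLinearMap.fst ℝ (Fin n → ℝ) (Fin k → ℝ))) (x, lam) :=
    HasFDerivAt.comp (x, lam) (f := fun p : (Fin n → ℝ) × (Fin k → ℝ) => p.1) hc hfst
  have hCi := fun i => (hasFDerivAt_pi'.1 hC) i
  have hSi := fun i => (hasFDerivAt_pi'.1 hsnd) i
  have hT1 := HasFDerivAt.fun_sum (u := Finset.univ) fun i _ => (hSi i).mul (hCi i)
  have hT2 := HasFDerivAt.fun_sum (u := Finset.univ) fun i _ => (hCi i).mul (hCi i)
  have hF := (hG.add hT1).add (hT2.const_mul (ρ / 2))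
  have key := congrArg (fun L => L (Δx, (0 : Fin k → ℝ))) hF.fderiv
  refine Eq.trans key ?_
  have e1 : gradg ⬝ᵥ Δx + lam ⬝ᵥ A.mulVec Δx = -(Δx ⬝ᵥ Q.mulVec Δx) + d ⬝ᵥ Δl := by
    have h3 := congrArg (fun v => Δx ⬝ᵥ v) h1
    simp only [hl, dotProduct_add, dotProduct_neg, mulVec_transpose] at h3
    rw [dotProduct_comm Δx (Δl ᵥ* A), dotProduct_comm Δx (lam ᵥ* A),
      ← dotProduct_mulVec, ← dotProduct_mulVec, h2, dotProduct_comm Δx gradg,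
      dotProduct_neg, dotProduct_comm Δl d] at h3
    rw [h2]
    linarith
  have e2 : (∑ i, lam i * (A.mulVec Δx) i) = lam ⬝ᵥ A.mulVec Δx := rfl
  have e3 : (∑ i, (c x i * (A.mulVec Δx) i + c x i * (A.mulVec Δx) i)) = -2 * (d ⬝ᵥ d) := by
    rw [h2, ← hd]
    simp only [dotProduct, Finset.mul_sum, Pi.neg_apply]
    exact Finset.sum_congr rfl fun i _ => by ring
  simp [hgrad, hA, -neg_mul]
  rw [e2, e3, e1]
  ring
end

section
/- Let g : ℝⁿ → ℝ and c : ℝⁿ → ℝᵏ be differentiable at x, let λ ∈ ℝᵏ, ρ ≥ 0, and set A = Dc(x), d = c(x), l = ∇g(x) + Aᵀλ. Suppose Δx ∈ ℝⁿ, Δλ ∈ ℝᵏ and a symmetric matrix Q ∈ ℝ^{n×n} satisfy Q·Δx + Aᵀ·Δλ = −l and A·Δx = −d. Then the directional derivative of the merit function m_ρ at (x, λ) in the direction (Δx, Δλ) equals −ΔxᵀQΔx + 2 dᵀΔλ − ρ‖d‖². -/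
open Matrix

/-- Directional derivative of the ℓ₂ augmented Lagrangian merit function
`m_ρ(x, λ) = g x + λᵀ c x + (ρ/2)‖c x‖²` in the direction `(Δx, Δl)`:
it equals `-ΔxᵀQΔx + dᵀΔλ - ρ‖d‖²` whenever `(Δx, Δλ)` solves the SQP
Newton-KKT system. -/
theorem merit_directional_derivative_full {n k : ℕ}
    (g : (Fin n → ℝ) → ℝ) (c : (Fin n → ℝ) → Fin k → ℝ)
    (x : Fin n → ℝ) (lam : Fin k → ℝ) (ρ : ℝ) (hρ : 0 ≤ ρ)
    (g' : (Fin n → ℝ) →L[ℝ] ℝ) (c' : (Fin n → ℝ) →L[ℝ] (Fin k → ℝ))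
    (hg : HasFDerivAt g g' x) (hc : HasFDerivAt c c' x)
    (gradg : Fin n → ℝ) (hgrad : ∀ v, g' v = gradg ⬝ᵥ v)
    (A : Matrix (Fin k) (Fin n) ℝ) (hA : ∀ v, c' v = A.mulVec v)
    (d : Fin k → ℝ) (hd : d = c x)
    (l : Fin n → ℝ) (hl : l = gradg + Aᵀ.mulVec lam)
    (Q : Matrix (Fin n) (Fin n) ℝ) (hQ : Q.IsSymm)
    (Δx : Fin n → ℝ) (Δl : Fin k → ℝ)
    (h1 : Q.mulVec Δx + Aᵀ.mulVec Δl = -l)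
    (h2 : A.mulVec Δx = -d) :
    fderiv ℝ
        (fun p : (Fin n → ℝ) × (Fin k → ℝ) =>
          g p.1 + p.2 ⬝ᵥ c p.1 + ρ / 2 * (c p.1 ⬝ᵥ c p.1)) (x, lam)
        (Δx, Δl)
      = -(Δx ⬝ᵥ Q.mulVec Δx) + 2 * (d ⬝ᵥ Δl) - ρ * (d ⬝ᵥ d) := by
  have hc1 : HasFDerivAt (fun p : (Fin n → ℝ) × (Fin k → ℝ) => c p.1)
      (c'.comp (ContinuousLinearMap.fst ℝ _ _)) (x, lam) :=
    HasFDerivAt.comp (x, lam) (f := Prod.fst) (g := c) hc hasFDerivAt_fst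
  have hg1 : HasFDerivAt (fun p : (Fin n → ℝ) × (Fin k → ℝ) => g p.1)
      (g'.comp (ContinuousLinearMap.fst ℝ _ _)) (x, lam) :=
    HasFDerivAt.comp (x, lam) (f := Prod.fst) (g := g) hg hasFDerivAt_fst
  have hl1 : HasFDerivAt (fun p : (Fin n → ℝ) × (Fin k → ℝ) => p.2)
      (ContinuousLinearMap.snd ℝ _ _) (x, lam) := hasFDerivAt_snd
  have hci := hasFDerivAt_pi'.1 hc1
  have hli := hasFDerivAt_pi'.1 hl1
  have hs1 := HasFDerivAt.fun_sum (u := Finset.univ) (fun i _ => (hli i).mul (hci i))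
  have hs2 := HasFDerivAt.fun_sum (u := Finset.univ) (fun i _ => (hci i).mul (hci i))
  have H := (hg1.add hs1).add (hs2.const_mul (ρ / 2))
  have key : fderiv ℝ
        (fun p : (Fin n → ℝ) × (Fin k → ℝ) =>
          g p.1 + p.2 ⬝ᵥ c p.1 + ρ / 2 * (c p.1 ⬝ᵥ c p.1)) (x, lam)
        (Δx, Δl) = g' Δx + (lam ⬝ᵥ c' Δx + c x ⬝ᵥ Δl)
          + ρ / 2 * (c x ⬝ᵥ c' Δx + c x ⬝ᵥ c' Δx) := by
    refine (congrArg (fun T => T (Δx, Δl)) H.fderiv).trans ?_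
    simp [dotProduct, Finset.sum_add_distrib]
    ring
  rw [key, hgrad, hA, ← hd, h2]
  have e1 : Δx ⬝ᵥ (Q.mulVec Δx + Aᵀ.mulVec Δl) = Δx ⬝ᵥ (-l) := by rw [h1]
  have e2 : ∀ v : Fin k → ℝ, Δx ⬝ᵥ Aᵀ.mulVec v = -(d ⬝ᵥ v) := by
    intro v
    rw [mulVec_transpose, dotProduct_comm, ← dotProduct_mulVec, h2, dotProduct_neg,
      dotProduct_comm]
  rw [hl, dotProduct_neg, dotProduct_add, dotProduct_add, e2, e2] at e1
  rw [dotProduct_comm gradg, dotProduct_neg, dotProduct_neg, dotProduct_comm lam]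
  linarith
end

section
/- Let g : ℝⁿ → ℝ and c : ℝⁿ → ℝᵏ be differentiable at x, let λ ∈ ℝᵏ, and set A = Dc(x), d = c(x), l = ∇g(x) + Aᵀλ. Suppose Δx ∈ ℝⁿ, Δλ ∈ ℝᵏ and a symmetric positive definite matrix Q ∈ ℝ^{n×n} satisfy Q·Δx + Aᵀ·Δλ = −l and A·Δx = −d, and suppose d ≠ 0. Then, taking ρ = 2‖Δλ‖/‖d‖, the directional derivative of the merit function m_ρ at (x, λ) in the direction (Δx, Δλ) is strictly negative. -/
open Matrix

lemma hasFDerivAt_dot_aux {E : Type*} [NormedAddCommGroup E] [NormedSpace ℝ E] {k : ℕ}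
    {u v : E → Fin k → ℝ} {u' v' : E →L[ℝ] (Fin k → ℝ)} {p : E}
    (hu : HasFDerivAt u u' p) (hv : HasFDerivAt v v' p) :
    ∃ D : E →L[ℝ] ℝ, HasFDerivAt (fun q => u q ⬝ᵥ v q) D p ∧
      ∀ w, D w = u p ⬝ᵥ v' w + u' w ⬝ᵥ v p := by
  have hu2 := hasFDerivAt_pi'.1 hu
  have hv2 := hasFDerivAt_pi'.1 hv
  refine ⟨_, HasFDerivAt.fun_sum (fun i _ => (hu2 i).mul (hv2 i)), ?_⟩
  intro w
  simp [dotProduct, Finset.sum_add_distrib, mul_comm]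

/-- With the penalty parameter choice `ρ = 2‖Δλ‖/‖d‖` (Euclidean norms), the
directional derivative of the merit function along the SQP step `(Δx, Δλ)` is
strictly negative whenever `d ≠ 0`. -/
theorem merit_descent_direction_penalty_choice {n k : ℕ}
    (g : (Fin n → ℝ) → ℝ) (c : (Fin n → ℝ) → Fin k → ℝ)
    (x : Fin n → ℝ) (lam : Fin k → ℝ)
    (g' : (Fin n → ℝ) →L[ℝ] ℝ) (c' : (Fin n → ℝ) →L[ℝ] (Fin k → ℝ))
    (hg : HasFDerivAt g g' x) (hc : HasFDerivAt c c' x)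
    (gradg : Fin n → ℝ) (hgrad : ∀ v, g' v = gradg ⬝ᵥ v)
    (A : Matrix (Fin k) (Fin n) ℝ) (hA : ∀ v, c' v = A.mulVec v)
    (d : Fin k → ℝ) (hd : d = c x)
    (l : Fin n → ℝ) (hl : l = gradg + Aᵀ.mulVec lam)
    (Q : Matrix (Fin n) (Fin n) ℝ) (hQ : Q.PosDef)
    (Δx : Fin n → ℝ) (Δl : Fin k → ℝ)
    (h1 : Q.mulVec Δx + Aᵀ.mulVec Δl = -l)
    (h2 : A.mulVec Δx = -d)
    (hdne : d ≠ 0)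
    (ρ : ℝ) (hρ : ρ = 2 * Real.sqrt (Δl ⬝ᵥ Δl) / Real.sqrt (d ⬝ᵥ d)) :
    fderiv ℝ
        (fun p : (Fin n → ℝ) × (Fin k → ℝ) =>
          g p.1 + p.2 ⬝ᵥ c p.1 + ρ / 2 * (c p.1 ⬝ᵥ c p.1)) (x, lam)
        (Δx, Δl)
      < 0 := by
  have hfst : HasFDerivAt (fun p : (Fin n → ℝ) × (Fin k → ℝ) => p.1)
      (ContinuousLinearMap.fst ℝ _ _) (x, lam) := hasFDerivAt_fst
  have hsnd : HasFDerivAt (fun p : (Fin n → ℝ) × (Fin k → ℝ) => p.2)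
      (ContinuousLinearMap.snd ℝ _ _) (x, lam) := hasFDerivAt_snd
  have hG : HasFDerivAt (fun p : (Fin n → ℝ) × (Fin k → ℝ) => g p.1)
      (g'.comp (ContinuousLinearMap.fst ℝ _ _)) (x, lam) :=
    HasFDerivAt.comp (x, lam) (g := g) hg hfst
  have hC : HasFDerivAt (fun p : (Fin n → ℝ) × (Fin k → ℝ) => c p.1)
      (c'.comp (ContinuousLinearMap.fst ℝ _ _)) (x, lam) :=
    HasFDerivAt.comp (x, lam) (g := c) hc hfst
  obtain ⟨D1, hD1, e1⟩ := hasFDerivAt_dot_aux hsnd hC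
  obtain ⟨D2, hD2, e2⟩ := hasFDerivAt_dot_aux hC hC
  rw [((hG.fun_add hD1).fun_add (hD2.const_mul (ρ / 2))).fderiv]
  have hval : (g'.comp (ContinuousLinearMap.fst ℝ (Fin n → ℝ) (Fin k → ℝ)) + D1 + (ρ / 2) • D2) (Δx, Δl)
      = gradg ⬝ᵥ Δx + (Δl ⬝ᵥ d - lam ⬝ᵥ d) - ρ * (d ⬝ᵥ d) := by
    simp [e1, e2, hgrad, hA, h2, ← hd]
    ring
  rw [hval]
  have hΔ : Δx ≠ 0 := by
    rintro rfl
    apply hdne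
    simpa using h2.symm
  have hpos : 0 < Δx ⬝ᵥ Q.mulVec Δx := by
    simpa using hQ.dotProduct_mulVec_pos hΔ
  have ht : ∀ y : Fin k → ℝ, Δx ⬝ᵥ Aᵀ.mulVec y = -(y ⬝ᵥ d) := by
    intro y
    rw [dotProduct_mulVec, vecMul_transpose, h2, neg_dotProduct, dotProduct_comm]
  have h3 := congrArg (fun z => Δx ⬝ᵥ z) h1
  simp only [hl, dotProduct_add, dotProduct_neg, ht] at h3
  rw [dotProduct_comm Δx gradg] at h3
  have hdd : 0 < d ⬝ᵥ d := by
    have h0 : 0 ≤ d ⬝ᵥ d := Finset.sum_nonneg fun i _ => mul_self_nonneg _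
    exact lt_of_le_of_ne h0 fun h => hdne (dotProduct_self_eq_zero.1 h.symm)
  have hs : 0 < Real.sqrt (d ⬝ᵥ d) := Real.sqrt_pos.2 hdd
  have hρd : ρ * (d ⬝ᵥ d) = 2 * (Real.sqrt (Δl ⬝ᵥ Δl) * Real.sqrt (d ⬝ᵥ d)) := by
    rw [hρ]
    nth_rewrite 2 [← Real.mul_self_sqrt hdd.le]
    field_simp
  have hcs : Δl ⬝ᵥ d ≤ Real.sqrt (Δl ⬝ᵥ Δl) * Real.sqrt (d ⬝ᵥ d) := by
    have := Real.sum_mul_le_sqrt_mul_sqrt Finset.univ Δl d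
    simpa [dotProduct, sq] using this
  rw [hρd]
  linarith
end

section
/- Let g : ℝⁿ → ℝ and c : ℝⁿ → ℝᵏ be differentiable at x, let λ ∈ ℝᵏ, ρ ≥ 0, and set A = Dc(x), d = c(x), l = ∇g(x) + Aᵀλ. Suppose Δx ∈ ℝⁿ, Δλ ∈ ℝᵏ and a symmetric positive definite matrix Q ∈ ℝ^{n×n} satisfy Q·Δx + Aᵀ·Δλ = −l and A·Δx = −d. If d = 0 and Δx ≠ 0, then the directional derivative of the merit function m_ρ at (x, λ) in the direction (Δx, Δλ) equals −ΔxᵀQΔx and is strictly negative. -/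
open Matrix

/-- When the constraints are satisfied (`d = 0`) but `Δx ≠ 0`, the directional
derivative of the merit function along the SQP step `(Δx, Δλ)` equals
`-ΔxᵀQΔx` and is strictly negative. -/
theorem merit_descent_direction_feasible_case {n k : ℕ}
    (g : (Fin n → ℝ) → ℝ) (c : (Fin n → ℝ) → Fin k → ℝ)
    (x : Fin n → ℝ) (lam : Fin k → ℝ) (ρ : ℝ) (hρ : 0 ≤ ρ)
    (g' : (Fin n → ℝ) →L[ℝ] ℝ) (c' : (Fin n → ℝ) →L[ℝ] (Fin k → ℝ))
    (hg : HasFDerivAt g g' x) (hc : HasFDerivAt c c' x)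
    (gradg : Fin n → ℝ) (hgrad : ∀ v, g' v = gradg ⬝ᵥ v)
    (A : Matrix (Fin k) (Fin n) ℝ) (hA : ∀ v, c' v = A.mulVec v)
    (d : Fin k → ℝ) (hd : d = c x)
    (l : Fin n → ℝ) (hl : l = gradg + Aᵀ.mulVec lam)
    (Q : Matrix (Fin n) (Fin n) ℝ) (hQ : Q.PosDef)
    (Δx : Fin n → ℝ) (Δl : Fin k → ℝ)
    (h1 : Q.mulVec Δx + Aᵀ.mulVec Δl = -l)
    (h2 : A.mulVec Δx = -d)
    (hd0 : d = 0) (hΔx : Δx ≠ 0) :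
    fderiv ℝ
        (fun p : (Fin n → ℝ) × (Fin k → ℝ) =>
          g p.1 + p.2 ⬝ᵥ c p.1 + ρ / 2 * (c p.1 ⬝ᵥ c p.1)) (x, lam)
        (Δx, Δl)
      = -(Δx ⬝ᵥ Q.mulVec Δx) ∧
    fderiv ℝ
        (fun p : (Fin n → ℝ) × (Fin k → ℝ) =>
          g p.1 + p.2 ⬝ᵥ c p.1 + ρ / 2 * (c p.1 ⬝ᵥ c p.1)) (x, lam)
        (Δx, Δl)
      < 0 := by
  have hcx : c x = 0 := by rw [← hd, hd0]
  have hAx : A.mulVec Δx = 0 := by rw [h2, hd0, neg_zero]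
  have hG : HasFDerivAt (fun p : (Fin n → ℝ) × (Fin k → ℝ) => g p.1)
      (g'.comp (ContinuousLinearMap.fst ℝ (Fin n → ℝ) (Fin k → ℝ))) (x, lam) :=
    HasFDerivAt.comp (x, lam) (f := Prod.fst) (by exact hg) hasFDerivAt_fst
  have hC : HasFDerivAt (fun p : (Fin n → ℝ) × (Fin k → ℝ) => c p.1)
      (c'.comp (ContinuousLinearMap.fst ℝ (Fin n → ℝ) (Fin k → ℝ))) (x, lam) :=
    HasFDerivAt.comp (x, lam) (f := Prod.fst) (by exact hc) hasFDerivAt_fst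
  have hS : HasFDerivAt (fun p : (Fin n → ℝ) × (Fin k → ℝ) => p.2)
      (ContinuousLinearMap.snd ℝ (Fin n → ℝ) (Fin k → ℝ)) (x, lam) := hasFDerivAt_snd
  have hCi := hasFDerivAt_pi'.1 hC
  have hSi := hasFDerivAt_pi'.1 hS
  have hM := (hG.add (HasFDerivAt.fun_sum (u := Finset.univ)
    (fun i _ => (hSi i).mul (hCi i)))).add
    ((HasFDerivAt.fun_sum (u := Finset.univ)
    (fun i _ => (hCi i).mul (hCi i))).const_mul (ρ / 2))
  have hz : ∀ v : Fin k → ℝ, Δx ⬝ᵥ Aᵀ.mulVec v = 0 := by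
    intro v
    rw [Matrix.mulVec_transpose, dotProduct_comm, ← Matrix.dotProduct_mulVec, hAx,
      dotProduct_zero]
  have key : fderiv ℝ
        (fun p : (Fin n → ℝ) × (Fin k → ℝ) =>
          g p.1 + p.2 ⬝ᵥ c p.1 + ρ / 2 * (c p.1 ⬝ᵥ c p.1)) (x, lam)
        (Δx, Δl)
      = -(Δx ⬝ᵥ Q.mulVec Δx) := by
    have e := congrArg (fun w => Δx ⬝ᵥ w) h1
    simp only [hl, dotProduct_add, dotProduct_neg, hz] at e
    have hv : fderiv ℝ
        (fun p : (Fin n → ℝ) × (Fin k → ℝ) =>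
          g p.1 + p.2 ⬝ᵥ c p.1 + ρ / 2 * (c p.1 ⬝ᵥ c p.1)) (x, lam)
        (Δx, Δl) = gradg ⬝ᵥ Δx := by
      refine (congrArg (fun L => L (Δx, Δl)) (HasFDerivAt.fderiv hM)).trans ?_
      simp [hcx, hA, hAx, hgrad]
    rw [hv, dotProduct_comm]
    linarith
  refine ⟨key, ?_⟩
  rw [key]
  have hp := hQ.dotProduct_mulVec_pos hΔx
  simp only [star_trivial] at hp
  linarith
end

section
/- Consider the LQR problem with horizon N ≥ 1: minimize Σ_{i=0}^{N−1} (½x_iᵀQ_ix_i + q_iᵀx_i + ½u_iᵀR_iu_i + r_iᵀu_i + x_iᵀM_iu_i) + ½x_NᵀQ_Nx_N + q_Nᵀx_N over x_0, …, x_N ∈ ℝⁿ, u_0, …, u_{N−1} ∈ ℝᵐ, subject to x_0 = s_0 and x_{i+1} = A_ix_i + B_iu_i + c_i for i = 0, …, N−1. Assume each R_i is symmetric positive definite, each block matrix [[Q_i, M_i], [M_iᵀ, R_i]] is positive semidefinite, and Q_N is symmetric positive semidefinite. Then every matrix G_i in the backward Riccati recursion is positive definite (so the recursion is well defined), and the trajectory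 defined by x_0* = s_0, u_i* = K_i x_i* + k_i, x_{i+1}* = A_i x_i* + B_i u_i* + c_i is a global minimizer of the LQR objective over all feasible trajectories. -/
open Matrix

theorem lqr_aux_G {n m : ℕ} (B : Matrix (Fin n) (Fin m) ℝ) (R : Matrix (Fin m) (Fin m) ℝ)
    (P' : Matrix (Fin n) (Fin n) ℝ) (hR : R.PosDef) (hP' : P'.PosSemidef) :
    (R + Bᵀ * P' * B).PosDef := by
  have h1 := hP'.conjTranspose_mul_mul_same B
  rw [Matrix.conjTranspose_eq_transpose_of_trivial] at h1
  exact hR.add_posSemidef h1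

theorem lqr_aux_P {n m : ℕ} (A Q P' : Matrix (Fin n) (Fin n) ℝ) (B M : Matrix (Fin n) (Fin m) ℝ)
    (R G : Matrix (Fin m) (Fin m) ℝ) (H K : Matrix (Fin m) (Fin n) ℝ)
    (hblock : (Matrix.fromBlocks Q M Mᵀ R).PosSemidef)
    (hP' : P'.PosSemidef)
    (hG : G = R + Bᵀ * P' * B) (hH : H = Bᵀ * P' * A + Mᵀ)
    (hGs : Gᵀ = G) (hGK : G * K = -H) :
    (Q + Aᵀ * P' * A + Kᵀ * H).PosSemidef := by
  have hPs : P'ᵀ = P' := by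
    have := hP'.1.eq
    rwa [Matrix.conjTranspose_eq_transpose_of_trivial] at this
  have h1 := hP'.conjTranspose_mul_mul_same (A + B * K)
  have h2 := hblock.conjTranspose_mul_mul_same (Matrix.fromRows (1 : Matrix (Fin n) (Fin n) ℝ) K)
  rw [Matrix.conjTranspose_eq_transpose_of_trivial] at h1 h2
  rw [Matrix.transpose_fromRows, Matrix.fromCols_mul_fromBlocks,
    Matrix.fromCols_mul_fromRows] at h2
  have h3 := h2.add h1
  have hKG : Kᵀ * G = -Hᵀ := by
    have := congrArg Matrix.transpose hGK
    rwa [Matrix.transpose_mul, hGs, Matrix.transpose_neg] at this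
  have hHt : Hᵀ = Aᵀ * P' * B + M := by
    rw [hH]; simp [Matrix.transpose_mul, hPs, Matrix.mul_assoc]
  have h4 : Kᵀ * G * K + Hᵀ * K = 0 := by rw [hKG]; simp
  rw [hHt, hG] at h4
  rw [hH]
  convert h3 using 1
  rw [← sub_eq_zero, ← neg_eq_zero, ← h4]
  simp only [Matrix.transpose_add, Matrix.transpose_mul, Matrix.transpose_one, Matrix.mul_add,
    Matrix.add_mul, Matrix.one_mul, Matrix.mul_one, Matrix.mul_assoc]
  abel

theorem lqr_aux_step {n m : ℕ} (A Q P' : Matrix (Fin n) (Fin n) ℝ)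
    (B M : Matrix (Fin n) (Fin m) ℝ)
    (R G : Matrix (Fin m) (Fin m) ℝ) (H K : Matrix (Fin m) (Fin n) ℝ)
    (q p' c x : Fin n → ℝ) (r h k u : Fin m → ℝ)
    (hPs : P'ᵀ = P') (hG : G = R + Bᵀ * P' * B) (hH : H = Bᵀ * P' * A + Mᵀ)
    (hh : h = Bᵀ.mulVec (p' + P'.mulVec c) + r)
    (hGs : Gᵀ = G) (hGK : G * K = -H) (hGk : G.mulVec k = -h) :
    (1 / 2 * (x ⬝ᵥ Q.mulVec x) + q ⬝ᵥ x + 1 / 2 * (u ⬝ᵥ R.mulVec u) + r ⬝ᵥ u + x ⬝ᵥ M.mulVec u)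
      + (1 / 2 * ((A.mulVec x + B.mulVec u + c) ⬝ᵥ P'.mulVec (A.mulVec x + B.mulVec u + c))
        + p' ⬝ᵥ (A.mulVec x + B.mulVec u + c))
    = (1 / 2 * (x ⬝ᵥ (Q + Aᵀ * P' * A + Kᵀ * H).mulVec x)
        + (q + Aᵀ.mulVec (p' + P'.mulVec c) + Kᵀ.mulVec h) ⬝ᵥ x)
      + (1 / 2 * (c ⬝ᵥ P'.mulVec c) + p' ⬝ᵥ c - 1 / 2 * (k ⬝ᵥ G.mulVec k))
      + 1 / 2 * ((u - (K.mulVec x + k)) ⬝ᵥ G.mulVec (u - (K.mulVec x + k))) := by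
  have tr : ∀ {a b : ℕ} (X : Matrix (Fin a) (Fin b) ℝ) (v : Fin b → ℝ) (w : Fin a → ℝ),
      v ⬝ᵥ Xᵀ.mulVec w = X.mulVec v ⬝ᵥ w := by
    intro a b X v w
    rw [Matrix.mulVec_transpose, dotProduct_comm, ← Matrix.dotProduct_mulVec, dotProduct_comm]
  have tr' : ∀ {a b : ℕ} (X : Matrix (Fin a) (Fin b) ℝ) (v : Fin b → ℝ) (w : Fin a → ℝ),
      Xᵀ.mulVec w ⬝ᵥ v = X.mulVec v ⬝ᵥ w := by
    intro a b X v w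
    rw [dotProduct_comm, tr]
  have sP : ∀ v w, v ⬝ᵥ P'.mulVec w = w ⬝ᵥ P'.mulVec v := by
    intro v w
    conv_lhs => rw [← hPs, tr, dotProduct_comm]
  have sG : ∀ v w, v ⬝ᵥ G.mulVec w = w ⬝ᵥ G.mulVec v := by
    intro v w
    conv_lhs => rw [← hGs, tr, dotProduct_comm]
  have gK : G.mulVec (K.mulVec x) = -H.mulVec x := by
    rw [Matrix.mulVec_mulVec, hGK, Matrix.neg_mulVec]
  have e1 : u ⬝ᵥ G.mulVec u = u ⬝ᵥ R.mulVec u + B.mulVec u ⬝ᵥ P'.mulVec (B.mulVec u) := by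
    rw [hG, Matrix.add_mulVec, dotProduct_add, ← Matrix.mulVec_mulVec, ← Matrix.mulVec_mulVec, tr]
  have e2 : u ⬝ᵥ H.mulVec x = B.mulVec u ⬝ᵥ P'.mulVec (A.mulVec x) + x ⬝ᵥ M.mulVec u := by
    rw [hH, Matrix.add_mulVec, dotProduct_add, ← Matrix.mulVec_mulVec, ← Matrix.mulVec_mulVec, tr,
      tr, dotProduct_comm (M.mulVec u)]
  have e3 : u ⬝ᵥ h = B.mulVec u ⬝ᵥ p' + B.mulVec u ⬝ᵥ P'.mulVec c + r ⬝ᵥ u := by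
    rw [hh, dotProduct_add, tr, dotProduct_add, dotProduct_comm u r]
  have e4 : x ⬝ᵥ (Q + Aᵀ * P' * A + Kᵀ * H).mulVec x = x ⬝ᵥ Q.mulVec x
      + A.mulVec x ⬝ᵥ P'.mulVec (A.mulVec x) + K.mulVec x ⬝ᵥ H.mulVec x := by
    simp only [Matrix.add_mulVec, dotProduct_add, ← Matrix.mulVec_mulVec, tr]
  have e5 : (q + Aᵀ.mulVec (p' + P'.mulVec c) + Kᵀ.mulVec h) ⬝ᵥ x = q ⬝ᵥ x
      + A.mulVec x ⬝ᵥ p' + A.mulVec x ⬝ᵥ P'.mulVec c + K.mulVec x ⬝ᵥ h := by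
    simp only [add_dotProduct, tr', dotProduct_add]; ring
  have e6 : (u - (K.mulVec x + k)) ⬝ᵥ G.mulVec (u - (K.mulVec x + k))
      = u ⬝ᵥ G.mulVec u + 2 * (u ⬝ᵥ H.mulVec x) + 2 * (u ⬝ᵥ h)
        - K.mulVec x ⬝ᵥ H.mulVec x - 2 * (K.mulVec x ⬝ᵥ h) + k ⬝ᵥ G.mulVec k := by
    have a1 : K.mulVec x ⬝ᵥ G.mulVec u = -(u ⬝ᵥ H.mulVec x) := by
      rw [sG, gK, dotProduct_neg]
    have a2 : k ⬝ᵥ G.mulVec u = -(u ⬝ᵥ h) := by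
      rw [sG, hGk, dotProduct_neg]
    have a3 : k ⬝ᵥ H.mulVec x = K.mulVec x ⬝ᵥ h := by
      have := sG k (K.mulVec x)
      rw [gK, hGk, dotProduct_neg, dotProduct_neg] at this
      linarith
    simp only [Matrix.mulVec_sub, Matrix.mulVec_add, sub_dotProduct, add_dotProduct,
      dotProduct_sub, dotProduct_add, a1, a2, gK, hGk, dotProduct_neg, a3]
    ring
  rw [e4, e5, e6, e1, e2, e3]
  simp only [Matrix.mulVec_add, add_dotProduct, dotProduct_add]
  rw [sP c (A.mulVec x), sP c (B.mulVec u), sP (B.mulVec u) (A.mulVec x),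
    dotProduct_comm p' (A.mulVec x), dotProduct_comm p' (B.mulVec u)]
  ring

theorem lqr_aux_tele {N : ℕ} (f : Fin (N + 1) → ℝ) :
    ∑ i : Fin N, (f i.succ - f i.castSucc) = f (Fin.last N) - f 0 := by
  have h1 := Fin.sum_univ_succ f
  have h2 := Fin.sum_univ_castSucc f
  rw [Finset.sum_sub_distrib]
  linarith

/-- The backward Riccati recursion of the LQR problem is well defined (every
`G i` is positive definite) and the trajectory produced by the forward pass
`u_i = K_i x_i + k_i`, `x_{i+1} = A_i x_i + B_i u_i + c_i` is a global
minimizer of the LQR objective over all feasible trajectories. -/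
theorem lqr_riccati_global_minimizer {n m N : ℕ} (hN : 1 ≤ N)
    (A : Fin N → Matrix (Fin n) (Fin n) ℝ) (B : Fin N → Matrix (Fin n) (Fin m) ℝ)
    (Q : Fin N → Matrix (Fin n) (Fin n) ℝ) (R : Fin N → Matrix (Fin m) (Fin m) ℝ)
    (M : Fin N → Matrix (Fin n) (Fin m) ℝ)
    (q : Fin N → Fin n → ℝ) (r : Fin N → Fin m → ℝ) (c : Fin N → Fin n → ℝ)
    (QN : Matrix (Fin n) (Fin n) ℝ) (qN : Fin n → ℝ) (s0 : Fin n → ℝ)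
    (hR : ∀ i, (R i).PosDef)
    (hblock : ∀ i, (Matrix.fromBlocks (Q i) (M i) (M i)ᵀ (R i)).PosSemidef)
    (hQN : QN.PosSemidef)
    -- the backward Riccati recursion
    (P : Fin (N + 1) → Matrix (Fin n) (Fin n) ℝ) (p : Fin (N + 1) → Fin n → ℝ)
    (G : Fin N → Matrix (Fin m) (Fin m) ℝ) (H : Fin N → Matrix (Fin m) (Fin n) ℝ)
    (h : Fin N → Fin m → ℝ) (K : Fin N → Matrix (Fin m) (Fin n) ℝ)
    (k : Fin N → Fin m → ℝ)
    (hPN : P (Fin.last N) = QN) (hpN : p (Fin.last N) = qN)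
    (hG : ∀ i, G i = R i + (B i)ᵀ * P i.succ * B i)
    (hH : ∀ i, H i = (B i)ᵀ * P i.succ * A i + (M i)ᵀ)
    (hh : ∀ i, h i = (B i)ᵀ.mulVec (p i.succ + (P i.succ).mulVec (c i)) + r i)
    (hK : ∀ i, K i = -((G i)⁻¹ * H i))
    (hk : ∀ i, k i = -((G i)⁻¹.mulVec (h i)))
    (hP : ∀ i, P i.castSucc = Q i + (A i)ᵀ * P i.succ * A i + (K i)ᵀ * H i)
    (hp : ∀ i, p i.castSucc
      = q i + (A i)ᵀ.mulVec (p i.succ + (P i.succ).mulVec (c i)) + (K i)ᵀ.mulVec (h i))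
    -- the trajectory produced by the forward pass
    (xs : Fin (N + 1) → Fin n → ℝ) (us : Fin N → Fin m → ℝ)
    (hxs0 : xs 0 = s0)
    (hus : ∀ i, us i = (K i).mulVec (xs i.castSucc) + k i)
    (hxs : ∀ i, xs i.succ = (A i).mulVec (xs i.castSucc) + (B i).mulVec (us i) + c i)
    -- the LQR objective
    (J : (Fin (N + 1) → Fin n → ℝ) → (Fin N → Fin m → ℝ) → ℝ)
    (hJ : ∀ x u, J x u
      = (∑ i : Fin N,
          (1 / 2 * (x i.castSucc ⬝ᵥ (Q i).mulVec (x i.castSucc))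
            + q i ⬝ᵥ x i.castSucc
            + 1 / 2 * (u i ⬝ᵥ (R i).mulVec (u i)) + r i ⬝ᵥ u i
            + x i.castSucc ⬝ᵥ (M i).mulVec (u i)))
        + 1 / 2 * (x (Fin.last N) ⬝ᵥ QN.mulVec (x (Fin.last N)))
        + qN ⬝ᵥ x (Fin.last N)) :
    (∀ i, (G i).PosDef) ∧
    ∀ (x : Fin (N + 1) → Fin n → ℝ) (u : Fin N → Fin m → ℝ),
      x 0 = s0 →
      (∀ i, x i.succ = (A i).mulVec (x i.castSucc) + (B i).mulVec (u i) + c i) →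
      J xs us ≤ J x u := by
  have tsymm : ∀ {a : ℕ} {X : Matrix (Fin a) (Fin a) ℝ}, X.IsHermitian → Xᵀ = X := by
    intro a X hX
    have := hX.eq
    rwa [Matrix.conjTranspose_eq_transpose_of_trivial] at this
  have gdef : ∀ i : Fin N, (P i.succ).PosSemidef → (G i).PosDef := by
    intro i hi
    rw [hG i]
    exact lqr_aux_G _ _ _ (hR i) hi
  have gK : ∀ i : Fin N, (G i).PosDef → G i * K i = -H i := by
    intro i hi
    have hu : IsUnit (G i).det := (Matrix.isUnit_iff_isUnit_det _).1 hi.isUnit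
    rw [hK i, Matrix.mul_neg, Matrix.mul_nonsing_inv_cancel_left _ _ hu]
  have gk : ∀ i : Fin N, (G i).PosDef → (G i).mulVec (k i) = -h i := by
    intro i hi
    have hu : IsUnit (G i).det := (Matrix.isUnit_iff_isUnit_det _).1 hi.isUnit
    rw [hk i, Matrix.mulVec_neg, Matrix.mulVec_mulVec, Matrix.mul_nonsing_inv _ hu,
      Matrix.one_mulVec]
  have hPall : ∀ j, (P j).PosSemidef := by
    intro j
    induction j using Fin.reverseInduction with
    | last => rw [hPN]; exact hQN
    | cast i ih =>
      have hgi := gdef i ih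
      rw [hP i]
      exact lqr_aux_P (A i) (Q i) (P i.succ) (B i) (M i) (R i) (G i) (H i) (K i) (hblock i) ih
        (hG i) (hH i) (tsymm hgi.1) (gK i hgi)
  have hGall : ∀ i, (G i).PosDef := fun i => gdef i (hPall _)
  refine ⟨hGall, ?_⟩
  -- completed-square form of the objective
  have key : ∀ (x : Fin (N + 1) → Fin n → ℝ) (u : Fin N → Fin m → ℝ), x 0 = s0 →
      (∀ i, x i.succ = (A i).mulVec (x i.castSucc) + (B i).mulVec (u i) + c i) →
      J x u = 1 / 2 * (s0 ⬝ᵥ (P 0).mulVec s0) + p 0 ⬝ᵥ s0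
        + ∑ i : Fin N, (1 / 2 * (c i ⬝ᵥ (P i.succ).mulVec (c i)) + p i.succ ⬝ᵥ c i
          - 1 / 2 * (k i ⬝ᵥ (G i).mulVec (k i)))
        + ∑ i : Fin N, 1 / 2 * ((u i - ((K i).mulVec (x i.castSucc) + k i)) ⬝ᵥ
          (G i).mulVec (u i - ((K i).mulVec (x i.castSucc) + k i))) := by
    intro x u hx0 hx
    have tele := lqr_aux_tele (fun j => 1 / 2 * (x j ⬝ᵥ (P j).mulVec (x j)) + p j ⬝ᵥ x j)
    simp only [hPN, hpN, hx0] at tele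
    have hsum : ∑ i : Fin N,
          (1 / 2 * (x i.castSucc ⬝ᵥ (Q i).mulVec (x i.castSucc))
            + q i ⬝ᵥ x i.castSucc
            + 1 / 2 * (u i ⬝ᵥ (R i).mulVec (u i)) + r i ⬝ᵥ u i
            + x i.castSucc ⬝ᵥ (M i).mulVec (u i))
        + ∑ i : Fin N, ((1 / 2 * (x i.succ ⬝ᵥ (P i.succ).mulVec (x i.succ))
            + p i.succ ⬝ᵥ x i.succ)
          - (1 / 2 * (x i.castSucc ⬝ᵥ (P i.castSucc).mulVec (x i.castSucc))
            + p i.castSucc ⬝ᵥ x i.castSucc))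
        = ∑ i : Fin N, (1 / 2 * (c i ⬝ᵥ (P i.succ).mulVec (c i)) + p i.succ ⬝ᵥ c i
          - 1 / 2 * (k i ⬝ᵥ (G i).mulVec (k i)))
        + ∑ i : Fin N, 1 / 2 * ((u i - ((K i).mulVec (x i.castSucc) + k i)) ⬝ᵥ
          (G i).mulVec (u i - ((K i).mulVec (x i.castSucc) + k i))) := by
      rw [← Finset.sum_add_distrib, ← Finset.sum_add_distrib]
      refine Finset.sum_congr rfl fun i _ => ?_
      have st := lqr_aux_step (A i) (Q i) (P i.succ) (B i) (M i) (R i) (G i) (H i) (K i)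
        (q i) (p i.succ) (c i) (x i.castSucc) (r i) (h i) (k i) (u i) (tsymm (hPall _).1)
        (hG i) (hH i) (hh i) (tsymm (hGall i).1) (gK i (hGall i)) (gk i (hGall i))
      rw [← hP i, ← hp i, ← hx i] at st
      linarith
    rw [hJ]
    linarith
  intro x u hx0 hx
  rw [key xs us hxs0 hxs, key x u hx0 hx]
  refine add_le_add le_rfl (Finset.sum_le_sum fun i _ => ?_)
  have hz : us i - ((K i).mulVec (xs i.castSucc) + k i) = 0 := by rw [hus i, sub_self]
  rw [hz]
  have := (hGall i).posSemidef.dotProduct_mulVec_nonneg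
    (u i - ((K i).mulVec (x i.castSucc) + k i))
  rw [star_trivial] at this
  simpa using this
end

section
/- Consider an LQR problem with horizon N ≥ 1 whose backward Riccati recursion is well defined (each G_i = R_i + B_iᵀP_{i+1}B_i is invertible). Let x_0, …, x_N and u_0, …, u_{N−1} satisfy u_i = K_i x_i + k_i and x_{i+1} = A_i x_i + B_i u_i + c_i for all i, and define λ_i := P_i x_i + p_i for i = 0, …, N. Then λ_N = Q_N x_N + q_N and, for every i = 0, …, N−1, λ_i = Q_i x_i + M_i u_i + A_iᵀ λ_{i+1} + q_i. That is, the costate sequence λ_i = P_i x_i + p_i satisfies the adjoint (state-stationarity) recursion of the LQR KKT system. -/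
open Matrix

/-- The costates `λ_i = P_i x_i + p_i` obtained from the cost-to-go functions of
the backward Riccati recursion satisfy the adjoint (state-stationarity)
recursion of the LQR KKT system: `λ_N = Q_N x_N + q_N` and
`λ_i = Q_i x_i + M_i u_i + A_iᵀ λ_{i+1} + q_i`. -/
theorem lqr_costate_satisfies_adjoint_recursion {n m N : ℕ} (hN : 1 ≤ N)
    (A : Fin N → Matrix (Fin n) (Fin n) ℝ) (B : Fin N → Matrix (Fin n) (Fin m) ℝ)
    (Q : Fin N → Matrix (Fin n) (Fin n) ℝ) (R : Fin N → Matrix (Fin m) (Fin m) ℝ)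
    (M : Fin N → Matrix (Fin n) (Fin m) ℝ)
    (q : Fin N → Fin n → ℝ) (r : Fin N → Fin m → ℝ) (c : Fin N → Fin n → ℝ)
    (QN : Matrix (Fin n) (Fin n) ℝ) (qN : Fin n → ℝ)
    (hQsymm : ∀ i, (Q i).IsSymm) (hRsymm : ∀ i, (R i).IsSymm) (hQN : QN.IsSymm)
    -- the backward Riccati recursion, assumed well defined
    (P : Fin (N + 1) → Matrix (Fin n) (Fin n) ℝ) (p : Fin (N + 1) → Fin n → ℝ)
    (G : Fin N → Matrix (Fin m) (Fin m) ℝ) (H : Fin N → Matrix (Fin m) (Fin n) ℝ)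
    (h : Fin N → Fin m → ℝ) (K : Fin N → Matrix (Fin m) (Fin n) ℝ)
    (k : Fin N → Fin m → ℝ)
    (hPN : P (Fin.last N) = QN) (hpN : p (Fin.last N) = qN)
    (hG : ∀ i, G i = R i + (B i)ᵀ * P i.succ * B i)
    (hGinv : ∀ i, IsUnit (G i))
    (hH : ∀ i, H i = (B i)ᵀ * P i.succ * A i + (M i)ᵀ)
    (hh : ∀ i, h i = (B i)ᵀ.mulVec (p i.succ + (P i.succ).mulVec (c i)) + r i)
    (hK : ∀ i, K i = -((G i)⁻¹ * H i))
    (hk : ∀ i, k i = -((G i)⁻¹.mulVec (h i)))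
    (hP : ∀ i, P i.castSucc = Q i + (A i)ᵀ * P i.succ * A i + (K i)ᵀ * H i)
    (hp : ∀ i, p i.castSucc
      = q i + (A i)ᵀ.mulVec (p i.succ + (P i.succ).mulVec (c i)) + (K i)ᵀ.mulVec (h i))
    -- a trajectory following the optimal feedback law
    (xs : Fin (N + 1) → Fin n → ℝ) (us : Fin N → Fin m → ℝ)
    (hus : ∀ i, us i = (K i).mulVec (xs i.castSucc) + k i)
    (hxs : ∀ i, xs i.succ = (A i).mulVec (xs i.castSucc) + (B i).mulVec (us i) + c i)
    -- the costates
    (lam : Fin (N + 1) → Fin n → ℝ)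
    (hlam : ∀ i, lam i = (P i).mulVec (xs i) + p i) :
    lam (Fin.last N) = QN.mulVec (xs (Fin.last N)) + qN ∧
    ∀ i : Fin N,
      lam i.castSucc
        = (Q i).mulVec (xs i.castSucc) + (M i).mulVec (us i)
          + (A i)ᵀ.mulVec (lam i.succ) + q i := by
  have hPs : ∀ j, (P j)ᵀ = P j := by
    intro j
    induction j using Fin.reverseInduction with
    | last => rw [hPN]; exact hQN
    | cast i ih =>
      have hGs : (G i)ᵀ = G i := by
        rw [hG]
        simp only [transpose_add, transpose_mul, transpose_transpose, ih, (hRsymm i).eq,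
          Matrix.mul_assoc]
      rw [hP, hK]
      simp only [transpose_add, transpose_mul, transpose_transpose, transpose_neg, ih,
        (hQsymm i).eq, Matrix.mul_assoc, transpose_nonsing_inv, hGs, Matrix.neg_mul,
        Matrix.mul_neg]
  refine ⟨by rw [hlam, hPN, hpN], fun i => ?_⟩
  have hGs : (G i)ᵀ = G i := by
    rw [hG]
    simp only [transpose_add, transpose_mul, transpose_transpose, hPs, (hRsymm i).eq,
      Matrix.mul_assoc]
  have hHt : (H i)ᵀ = (A i)ᵀ * P i.succ * B i + M i := by
    rw [hH]
    simp only [transpose_add, transpose_mul, transpose_transpose, hPs, Matrix.mul_assoc]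
  have h1 : (K i)ᵀ * H i = (H i)ᵀ * K i := by
    rw [hK]
    simp only [transpose_neg, transpose_mul, transpose_nonsing_inv, hGs, Matrix.neg_mul,
      Matrix.mul_neg, Matrix.mul_assoc]
  have h2 : (K i)ᵀ.mulVec (h i) = (H i)ᵀ.mulVec (k i) := by
    rw [hK, hk]
    simp only [transpose_neg, transpose_mul, transpose_nonsing_inv, hGs, Matrix.neg_mulVec,
      Matrix.mulVec_neg, Matrix.mulVec_mulVec]
  have h3 : (H i)ᵀ.mulVec ((K i).mulVec (xs i.castSucc)) + (H i)ᵀ.mulVec (k i)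
      = ((A i)ᵀ * P i.succ * B i).mulVec (us i) + (M i).mulVec (us i) := by
    rw [← Matrix.mulVec_add, ← hus, hHt, Matrix.add_mulVec]
  rw [hlam, hlam, hP, hp, hxs, h1, h2]
  simp only [Matrix.add_mulVec, Matrix.mulVec_add, ← Matrix.mulVec_mulVec] at h3 ⊢
  linear_combination (exp := 1) h3
end

section
/- Consider an LQR problem with horizon N ≥ 1 whose backward Riccati recursion is well defined (each G_i = R_i + B_iᵀP_{i+1}B_i is invertible). Let x_0, …, x_N and u_0, …, u_{N−1} satisfy u_i = K_i x_i + k_i and x_{i+1} = A_i x_i + B_i u_i + c_i for all i, and define λ_{i+1} := P_{i+1} x_{i+1} + p_{i+1}. Then for every i = 0, …, N−1, the control-stationarity equation R_i u_i + M_iᵀ x_i + B_iᵀ λ_{i+1} + r_i = 0 holds. That is, the multipliers computed from the cost-to-go functions also satisfy the block-rows of the Newton-KKT system involving the B_i. -/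
open Matrix

/-- The multipliers `λ_{i+1} = P_{i+1} x_{i+1} + p_{i+1}` computed from the
cost-to-go functions satisfy the control-stationarity equations
`R_i u_i + M_iᵀ x_i + B_iᵀ λ_{i+1} + r_i = 0` of the LQR KKT system. -/
theorem lqr_costate_satisfies_control_stationarity {n m N : ℕ} (hN : 1 ≤ N)
    (A : Fin N → Matrix (Fin n) (Fin n) ℝ) (B : Fin N → Matrix (Fin n) (Fin m) ℝ)
    (Q : Fin N → Matrix (Fin n) (Fin n) ℝ) (R : Fin N → Matrix (Fin m) (Fin m) ℝ)
    (M : Fin N → Matrix (Fin n) (Fin m) ℝ)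
    (q : Fin N → Fin n → ℝ) (r : Fin N → Fin m → ℝ) (c : Fin N → Fin n → ℝ)
    (QN : Matrix (Fin n) (Fin n) ℝ) (qN : Fin n → ℝ)
    (hQsymm : ∀ i, (Q i).IsSymm) (hRsymm : ∀ i, (R i).IsSymm) (hQN : QN.IsSymm)
    -- the backward Riccati recursion, assumed well defined
    (P : Fin (N + 1) → Matrix (Fin n) (Fin n) ℝ) (p : Fin (N + 1) → Fin n → ℝ)
    (G : Fin N → Matrix (Fin m) (Fin m) ℝ) (H : Fin N → Matrix (Fin m) (Fin n) ℝ)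
    (h : Fin N → Fin m → ℝ) (K : Fin N → Matrix (Fin m) (Fin n) ℝ)
    (k : Fin N → Fin m → ℝ)
    (hPN : P (Fin.last N) = QN) (hpN : p (Fin.last N) = qN)
    (hG : ∀ i, G i = R i + (B i)ᵀ * P i.succ * B i)
    (hGinv : ∀ i, IsUnit (G i))
    (hH : ∀ i, H i = (B i)ᵀ * P i.succ * A i + (M i)ᵀ)
    (hh : ∀ i, h i = (B i)ᵀ.mulVec (p i.succ + (P i.succ).mulVec (c i)) + r i)
    (hK : ∀ i, K i = -((G i)⁻¹ * H i))
    (hk : ∀ i, k i = -((G i)⁻¹.mulVec (h i)))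
    (hP : ∀ i, P i.castSucc = Q i + (A i)ᵀ * P i.succ * A i + (K i)ᵀ * H i)
    (hp : ∀ i, p i.castSucc
      = q i + (A i)ᵀ.mulVec (p i.succ + (P i.succ).mulVec (c i)) + (K i)ᵀ.mulVec (h i))
    -- a trajectory following the optimal feedback law
    (xs : Fin (N + 1) → Fin n → ℝ) (us : Fin N → Fin m → ℝ)
    (hus : ∀ i, us i = (K i).mulVec (xs i.castSucc) + k i)
    (hxs : ∀ i, xs i.succ = (A i).mulVec (xs i.castSucc) + (B i).mulVec (us i) + c i)
    -- the costates
    (lam : Fin (N + 1) → Fin n → ℝ)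
    (hlam : ∀ i : Fin N, lam i.succ = (P i.succ).mulVec (xs i.succ) + p i.succ) :
    ∀ i : Fin N,
      (R i).mulVec (us i) + (M i)ᵀ.mulVec (xs i.castSucc)
        + (B i)ᵀ.mulVec (lam i.succ) + r i = 0 := by
  intro i
  have hdet : IsUnit (G i).det := (Matrix.isUnit_iff_isUnit_det _).1 (hGinv i)
  have key : (G i).mulVec (us i) + (H i).mulVec (xs i.castSucc) + h i = 0 := by
    rw [hus, hK, hk, Matrix.mulVec_add, Matrix.mulVec_neg, Matrix.mulVec_mulVec,
      Matrix.mulVec_mulVec, Matrix.mul_neg, Matrix.mul_nonsing_inv_cancel_left _ _ hdet,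
      Matrix.mul_nonsing_inv _ hdet, Matrix.one_mulVec, Matrix.neg_mulVec]
    abel
  rw [← key, hlam, hxs, hG, hH, hh]
  simp only [Matrix.mulVec_add, Matrix.add_mulVec, Matrix.mulVec_mulVec, Matrix.mul_assoc]
  abel
end

section
/- Let C₁, C₂ ∈ ℝ^{n×n} be symmetric positive definite, P₂ ∈ ℝ^{n×n} symmetric positive semidefinite, P₁ ∈ ℝ^{n×n} symmetric, A₁, A₂ ∈ ℝ^{n×n}, p₁, p₂, c₁, c₂ ∈ ℝⁿ. Then I + P₂C₁ and I + C₁P₂ are invertible; define P₃ = A₁ᵀ(I + P₂C₁)⁻¹P₂A₁ + P₁, p₃ = A₁ᵀ(I + P₂C₁)⁻¹(p₂ + P₂c₁) + p₁, A₃ = A₂(I + C₁P₂)⁻¹A₁, C₃ = A₂(I + C₁P₂)⁻¹C₁A₂ᵀ + C₂, c₃ = A₂(I + C₁P₂)⁻¹(c₁ − C₁p₂) + c₂. Define V₁(x, y) = ½xᵀP₁x + p₁ᵀx + ½(y − A₁x − c₁)ᵀC₁⁻¹(y − A₁x − c₁) and V₂(y, z) = ½yᵀP₂y + p₂ᵀy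 + ½(z − A₂y − c₂)ᵀC₂⁻¹(z − A₂y − c₂). Then C₃ is positive definite, and there exists a constant κ ∈ ℝ such that for all x, z ∈ ℝⁿ, inf over y ∈ ℝⁿ of V₁(x, y) + V₂(y, z) equals ½xᵀP₃x + p₃ᵀx + ½(z − A₃x − c₃)ᵀC₃⁻¹(z − A₃x − c₃) + κ, and the infimum is attained. -/
open Matrix

lemma symm_dot {n : ℕ} {S : Matrix (Fin n) (Fin n) ℝ} (hS : Sᵀ = S) (u v : Fin n → ℝ) :
    u ⬝ᵥ S *ᵥ v = v ⬝ᵥ S *ᵥ u := by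
  conv_rhs => rw [← hS, mulVec_transpose, ← dotProduct_comm, ← dotProduct_mulVec]

lemma square_aux {n : ℕ} {K P : Matrix (Fin n) (Fin n) ℝ} (hK : Kᵀ = K) (hP : Pᵀ = P)
    (m p a y : Fin n → ℝ) (ha : (K + P) *ᵥ a = K *ᵥ m - p) :
    1 / 2 * ((y - m) ⬝ᵥ K *ᵥ (y - m)) + 1 / 2 * (y ⬝ᵥ P *ᵥ y) + p ⬝ᵥ y
      = 1 / 2 * ((y - a) ⬝ᵥ (K + P) *ᵥ (y - a))
        + (1 / 2 * (m ⬝ᵥ K *ᵥ m) - 1 / 2 * (a ⬝ᵥ (K + P) *ᵥ a)) := by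
  have hM : (K + P)ᵀ = K + P := by rw [transpose_add, hK, hP]
  have h1 : y ⬝ᵥ (K + P) *ᵥ a = y ⬝ᵥ K *ᵥ m - y ⬝ᵥ p := by rw [ha, dotProduct_sub]
  have h2 := symm_dot hM y a
  have h3 := symm_dot hK y m
  have h4 : y ⬝ᵥ (K + P) *ᵥ y = y ⬝ᵥ K *ᵥ y + y ⬝ᵥ P *ᵥ y := by
    rw [add_mulVec, dotProduct_add]
  have h5 := dotProduct_comm p y
  simp only [mulVec_sub, dotProduct_sub, sub_dotProduct]
  linarith

lemma min_aux {n : ℕ} {M L A : Matrix (Fin n) (Fin n) ℝ} (hM : M.PosSemidef) (hL : L.PosSemidef)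
    (l u z w : Fin n → ℝ) (hu : M *ᵥ u = Aᵀ *ᵥ l) (hz : L *ᵥ (z - A *ᵥ u) = l) :
    1 / 2 * (u ⬝ᵥ M *ᵥ u) + 1 / 2 * ((z - A *ᵥ u) ⬝ᵥ L *ᵥ (z - A *ᵥ u)) ≤
      1 / 2 * (w ⬝ᵥ M *ᵥ w) + 1 / 2 * ((z - A *ᵥ w) ⬝ᵥ L *ᵥ (z - A *ᵥ w)) := by
  obtain ⟨d, rfl⟩ : ∃ d, w = u + d := ⟨w - u, by simp⟩
  have hMs : Mᵀ = M := by simpa only [IsHermitian, conjTranspose_eq_transpose_of_trivial] using hM.1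
  have hLs : Lᵀ = L := by simpa only [IsHermitian, conjTranspose_eq_transpose_of_trivial] using hL.1
  have e : z - A *ᵥ (u + d) = (z - A *ᵥ u) - A *ᵥ d := by rw [mulVec_add]; abel
  rw [e]
  generalize z - A *ᵥ u = v at *
  have h1 : d ⬝ᵥ M *ᵥ u = (A *ᵥ d) ⬝ᵥ l := by
    rw [hu, mulVec_transpose, dotProduct_comm, ← dotProduct_mulVec, dotProduct_comm]
  have h2 : (A *ᵥ d) ⬝ᵥ L *ᵥ v = (A *ᵥ d) ⬝ᵥ l := by rw [hz]
  have h3 := symm_dot hMs u d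
  have h4 := symm_dot hLs v (A *ᵥ d)
  have h5 : 0 ≤ d ⬝ᵥ M *ᵥ d := by simpa using hM.dotProduct_mulVec_nonneg d
  have h6 : 0 ≤ (A *ᵥ d) ⬝ᵥ L *ᵥ (A *ᵥ d) := by
    simpa using hL.dotProduct_mulVec_nonneg (A *ᵥ d)
  simp only [mulVec_sub, mulVec_add, dotProduct_sub, sub_dotProduct, dotProduct_add,
    add_dotProduct] at *
  linarith

lemma rest_aux {n : ℕ} {K P W A : Matrix (Fin n) (Fin n) ℝ} (hK : Kᵀ = K) (hP : Pᵀ = P)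
    (hW : Wᵀ = W) (hMW : (K + P) * W = 1) (hWM : W * (K + P) = 1) (c p x : Fin n → ℝ) :
    1 / 2 * ((A *ᵥ x + c) ⬝ᵥ K *ᵥ (A *ᵥ x + c))
      - 1 / 2 * ((W *ᵥ (K *ᵥ (A *ᵥ x + c) - p)) ⬝ᵥ
          (K + P) *ᵥ (W *ᵥ (K *ᵥ (A *ᵥ x + c) - p)))
    = 1 / 2 * (x ⬝ᵥ (Aᵀ * (K * W) * P * A) *ᵥ x) + (Aᵀ *ᵥ ((K * W) *ᵥ (p + P *ᵥ c))) ⬝ᵥ x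
      + (1 / 2 * (c ⬝ᵥ (K * W * P) *ᵥ c) + p ⬝ᵥ (W * K) *ᵥ c - 1 / 2 * (p ⬝ᵥ W *ᵥ p)) := by
  have hQ : K * W * P = K - K * W * K := by
    have : K * (W * (K + P)) = K := by rw [hWM, mul_one]
    rw [mul_add, mul_add, ← mul_assoc, ← mul_assoc] at this
    rw [eq_sub_iff_add_eq, add_comm, this]
  have hQs : (K * W * P)ᵀ = K * W * P := by
    rw [hQ]; simp [transpose_sub, transpose_mul, hK, hW, mul_assoc]
  have e1 : x ⬝ᵥ (Aᵀ * (K * W) * P * A) *ᵥ x = (A *ᵥ x) ⬝ᵥ (K * W * P) *ᵥ (A *ᵥ x) := by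
    rw [show Aᵀ * (K * W) * P * A = Aᵀ * (K * W * P * A) by simp only [mul_assoc],
      ← mulVec_mulVec, mulVec_transpose, dotProduct_comm, ← dotProduct_mulVec, dotProduct_comm,
      mulVec_mulVec]
  have e2 : (Aᵀ *ᵥ ((K * W) *ᵥ (p + P *ᵥ c))) ⬝ᵥ x
      = p ⬝ᵥ (W * K) *ᵥ (A *ᵥ x) + (A *ᵥ x) ⬝ᵥ (K * W * P) *ᵥ c := by
    rw [mulVec_transpose, ← dotProduct_mulVec, mulVec_add, add_dotProduct, mulVec_mulVec,
      dotProduct_comm (A *ᵥ x)]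
    congr 1
    rw [dotProduct_mulVec p, ← mulVec_transpose, transpose_mul, hK, hW]
  rw [e1, e2]
  generalize A *ᵥ x = b
  rw [mulVec_mulVec, hMW, one_mulVec]
  have e3 : ∀ v, (W *ᵥ v) ⬝ᵥ v = v ⬝ᵥ W *ᵥ v := fun v => dotProduct_comm _ _
  rw [e3]
  have q1 : ∀ s t : Fin n → ℝ, s ⬝ᵥ (K * W * P) *ᵥ t = s ⬝ᵥ K *ᵥ t - (K *ᵥ s) ⬝ᵥ W *ᵥ (K *ᵥ t) := by
    intro s t
    rw [hQ, sub_mulVec, dotProduct_sub, mulVec_mulVec]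
    congr 1
    rw [mul_assoc, ← mulVec_mulVec, dotProduct_mulVec, ← mulVec_transpose, hK]
  have q2 := symm_dot hK b c
  have q3 := symm_dot hW (K *ᵥ b) (K *ᵥ c)
  have q4 := symm_dot hW p (K *ᵥ c)
  have q5 := symm_dot hW p (K *ᵥ b)
  rw [q1, q1, q1]
  simp only [← mulVec_mulVec, mulVec_add, mulVec_sub, dotProduct_sub, sub_dotProduct,
    dotProduct_add, add_dotProduct]
  linarith

/-- The combination rule of the parallel associative-scan LQR algorithm:
partial minimization of `V₁(x, y) + V₂(y, z)` over the intermediate state `y`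
yields an interval value function with parameters
`(P₃, p₃, A₃, C₃, c₃)` given by the stated combination formulas, up to an
additive constant `κ`, and the minimum is attained. Moreover `I + P₂C₁` and
`I + C₁P₂` are invertible and `C₃` is positive definite. -/
theorem parallel_lqr_combination_rule {n : ℕ}
    (C₁ C₂ : Matrix (Fin n) (Fin n) ℝ) (hC₁ : C₁.PosDef) (hC₂ : C₂.PosDef)
    (P₂ : Matrix (Fin n) (Fin n) ℝ) (hP₂ : P₂.PosSemidef)
    (P₁ : Matrix (Fin n) (Fin n) ℝ) (hP₁ : P₁.IsSymm)
    (A₁ A₂ : Matrix (Fin n) (Fin n) ℝ) (p₁ p₂ c₁ c₂ : Fin n → ℝ)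
    (P₃ : Matrix (Fin n) (Fin n) ℝ)
    (hP₃ : P₃ = A₁ᵀ * (1 + P₂ * C₁)⁻¹ * P₂ * A₁ + P₁)
    (p₃ : Fin n → ℝ)
    (hp₃ : p₃ = A₁ᵀ.mulVec ((1 + P₂ * C₁)⁻¹.mulVec (p₂ + P₂.mulVec c₁)) + p₁)
    (A₃ : Matrix (Fin n) (Fin n) ℝ)
    (hA₃ : A₃ = A₂ * (1 + C₁ * P₂)⁻¹ * A₁)
    (C₃ : Matrix (Fin n) (Fin n) ℝ)
    (hC₃ : C₃ = A₂ * (1 + C₁ * P₂)⁻¹ * C₁ * A₂ᵀ + C₂)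
    (c₃ : Fin n → ℝ)
    (hc₃ : c₃ = A₂.mulVec ((1 + C₁ * P₂)⁻¹.mulVec (c₁ - C₁.mulVec p₂)) + c₂)
    (V₁ V₂ : (Fin n → ℝ) → (Fin n → ℝ) → ℝ)
    (hV₁ : ∀ x y, V₁ x y
      = 1 / 2 * (x ⬝ᵥ P₁.mulVec x) + p₁ ⬝ᵥ x
        + 1 / 2 * ((y - A₁.mulVec x - c₁) ⬝ᵥ C₁⁻¹.mulVec (y - A₁.mulVec x - c₁)))
    (hV₂ : ∀ y z, V₂ y z
      = 1 / 2 * (y ⬝ᵥ P₂.mulVec y) + p₂ ⬝ᵥ y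
        + 1 / 2 * ((z - A₂.mulVec y - c₂) ⬝ᵥ C₂⁻¹.mulVec (z - A₂.mulVec y - c₂))) :
    IsUnit (1 + P₂ * C₁) ∧ IsUnit (1 + C₁ * P₂) ∧ C₃.PosDef ∧
    ∃ κ : ℝ, ∀ x z : Fin n → ℝ, ∃ y0 : Fin n → ℝ,
      (∀ y : Fin n → ℝ, V₁ x y0 + V₂ y0 z ≤ V₁ x y + V₂ y z) ∧
      V₁ x y0 + V₂ y0 z
        = 1 / 2 * (x ⬝ᵥ P₃.mulVec x) + p₃ ⬝ᵥ x
          + 1 / 2 * ((z - A₃.mulVec x - c₃) ⬝ᵥ C₃⁻¹.mulVec (z - A₃.mulVec x - c₃))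
          + κ := by
  have hKpd : C₁⁻¹.PosDef := hC₁.inv
  have hLpd : C₂⁻¹.PosDef := hC₂.inv
  have hMpd : (C₁⁻¹ + P₂).PosDef := hKpd.add_posSemidef hP₂
  have hWpd : (C₁⁻¹ + P₂)⁻¹.PosDef := hMpd.inv
  have hd1 : IsUnit C₁.det := (isUnit_iff_isUnit_det _).1 hC₁.isUnit
  have hd2 : IsUnit C₂.det := (isUnit_iff_isUnit_det _).1 hC₂.isUnit
  have hdM : IsUnit (C₁⁻¹ + P₂).det := (isUnit_iff_isUnit_det _).1 hMpd.isUnit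
  have f1 : 1 + P₂ * C₁ = (C₁⁻¹ + P₂) * C₁ := by rw [add_mul, nonsing_inv_mul _ hd1]
  have f2 : 1 + C₁ * P₂ = C₁ * (C₁⁻¹ + P₂) := by rw [mul_add, mul_nonsing_inv _ hd1]
  have i1 : (1 + P₂ * C₁)⁻¹ = C₁⁻¹ * (C₁⁻¹ + P₂)⁻¹ := by rw [f1, Matrix.mul_inv_rev]
  have i2 : (1 + C₁ * P₂)⁻¹ = (C₁⁻¹ + P₂)⁻¹ * C₁⁻¹ := by rw [f2, Matrix.mul_inv_rev]
  have hMW : (C₁⁻¹ + P₂) * (C₁⁻¹ + P₂)⁻¹ = 1 := mul_nonsing_inv _ hdM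
  have hWM : (C₁⁻¹ + P₂)⁻¹ * (C₁⁻¹ + P₂) = 1 := nonsing_inv_mul _ hdM
  have hKs : C₁⁻¹ᵀ = C₁⁻¹ := by simpa only [IsHermitian, conjTranspose_eq_transpose_of_trivial] using hKpd.1
  have hPs : P₂ᵀ = P₂ := by simpa only [IsHermitian, conjTranspose_eq_transpose_of_trivial] using hP₂.1
  have hWs : (C₁⁻¹ + P₂)⁻¹ᵀ = (C₁⁻¹ + P₂)⁻¹ := by
    rw [transpose_nonsing_inv, transpose_add, hKs, hPs]
  refine ⟨f1 ▸ hMpd.isUnit.mul hC₁.isUnit, f2 ▸ hC₁.isUnit.mul hMpd.isUnit, ?_⟩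
  rw [i2] at hA₃ hC₃ hc₃
  rw [i1] at hP₃ hp₃
  have hKC : C₁⁻¹ * C₁ = 1 := nonsing_inv_mul _ hd1
  have hLC : C₂⁻¹ * C₂ = 1 := nonsing_inv_mul _ hd2
  generalize C₁⁻¹ = K at *
  generalize (K + P₂)⁻¹ = W at *
  have hC₃e : C₃ = A₂ * W * A₂ᵀ + C₂ := by
    rw [hC₃]; congr 2
    rw [mul_assoc, mul_assoc, hKC, mul_one]
  have hC₃pd : C₃.PosDef := by
    rw [hC₃e]
    refine PosDef.posSemidef_add ?_ hC₂
    simpa only [conjTranspose_eq_transpose_of_trivial] using hWpd.posSemidef.mul_mul_conjTranspose_same A₂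
  refine ⟨hC₃pd, 1 / 2 * (c₁ ⬝ᵥ (K * W * P₂) *ᵥ c₁) + p₂ ⬝ᵥ (W * K) *ᵥ c₁
    - 1 / 2 * (p₂ ⬝ᵥ W *ᵥ p₂), fun x z => ?_⟩
  have hd3 : IsUnit C₃.det := (isUnit_iff_isUnit_det _).1 hC₃pd.isUnit
  obtain ⟨a, ha⟩ : ∃ a, a = W *ᵥ (K *ᵥ (A₁ *ᵥ x + c₁) - p₂) := ⟨_, rfl⟩
  obtain ⟨zz, hzz⟩ : ∃ zz, zz = z - A₃ *ᵥ x - c₃ := ⟨_, rfl⟩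
  obtain ⟨l, hl⟩ : ∃ l, l = C₃⁻¹ *ᵥ zz := ⟨_, rfl⟩
  have hzl : zz = C₃ *ᵥ l := by rw [hl, mulVec_mulVec, mul_nonsing_inv _ hd3, one_mulVec]
  have hMa : (K + P₂) *ᵥ a = K *ᵥ (A₁ *ᵥ x + c₁) - p₂ := by
    rw [ha, mulVec_mulVec, hMW, one_mulVec]
  have hAa : ∀ y, z - A₂ *ᵥ y - c₂ = zz - A₂ *ᵥ (y - a) := by
    intro y
    have : A₃ *ᵥ x + c₃ = A₂ *ᵥ a + c₂ := by
      rw [hA₃, hc₃, ha, ← add_assoc]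
      congr 1
      simp only [← mulVec_mulVec, mulVec_sub, mulVec_add]
      rw [mulVec_mulVec p₂ K C₁, hKC, one_mulVec]
      abel
    rw [hzz, mulVec_sub, sub_sub z (A₃ *ᵥ x), this]
    abel
  have hsplit : ∀ y, V₁ x y + V₂ y z = 1 / 2 * (x ⬝ᵥ P₁ *ᵥ x) + p₁ ⬝ᵥ x
      + (1 / 2 * ((A₁ *ᵥ x + c₁) ⬝ᵥ K *ᵥ (A₁ *ᵥ x + c₁)) - 1 / 2 * (a ⬝ᵥ (K + P₂) *ᵥ a))
      + (1 / 2 * ((y - a) ⬝ᵥ (K + P₂) *ᵥ (y - a))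
        + 1 / 2 * ((zz - A₂ *ᵥ (y - a)) ⬝ᵥ C₂⁻¹ *ᵥ (zz - A₂ *ᵥ (y - a)))) := by
    intro y
    rw [hV₁, hV₂, hAa, sub_sub]
    have := square_aux hKs hPs (A₁ *ᵥ x + c₁) p₂ a y hMa
    linarith
  obtain ⟨u, hu⟩ : ∃ u, u = W *ᵥ (A₂ᵀ *ᵥ l) := ⟨_, rfl⟩
  have hMu : (K + P₂) *ᵥ u = A₂ᵀ *ᵥ l := by rw [hu, mulVec_mulVec, hMW, one_mulVec]
  have hzu : zz - A₂ *ᵥ u = C₂ *ᵥ l := by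
    rw [hzl, hu, hC₃e, add_mulVec]
    simp only [← mulVec_mulVec]
    abel
  have hLz : C₂⁻¹ *ᵥ (zz - A₂ *ᵥ u) = l := by rw [hzu, mulVec_mulVec, hLC, one_mulVec]
  refine ⟨a + u, fun y => ?_, ?_⟩
  · rw [hsplit, hsplit y, add_sub_cancel_left]
    have := min_aux hMpd.posSemidef hLpd.posSemidef l u zz (y - a) hMu hLz
    linarith
  · rw [hsplit, add_sub_cancel_left, hLz, hMu, ← hzz, ← hl]
    have h1 := rest_aux (A := A₁) hKs hPs hWs hMW hWM c₁ p₂ x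
    rw [← ha] at h1
    have h2 : u ⬝ᵥ A₂ᵀ *ᵥ l = (A₂ *ᵥ u) ⬝ᵥ l := by
      rw [mulVec_transpose, dotProduct_comm, ← dotProduct_mulVec, dotProduct_comm]
    rw [h1, h2, hP₃, hp₃, add_mulVec, dotProduct_add, add_dotProduct, sub_dotProduct]
    ring
end

section
/- Let R ∈ ℝ^{m×m} be symmetric positive definite, P ∈ ℝ^{n×n} symmetric positive semidefinite, Q ∈ ℝ^{n×n} symmetric, M ∈ ℝ^{n×m}, A ∈ ℝ^{n×n}, B ∈ ℝ^{n×m}. Then I + P B R⁻¹ Bᵀ and R + BᵀPB are invertible, and the following matrix identity holds: (A − BR⁻¹Mᵀ)ᵀ (I + P B R⁻¹ Bᵀ)⁻¹ P (A − BR⁻¹Mᵀ) + Q − MR⁻¹Mᵀ = Q + AᵀPA − (BᵀPA + Mᵀ)ᵀ (R + BᵀPB)⁻¹ (BᵀPA + Mᵀ). -/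
open Matrix

/-- The cost-to-go matrix produced by one combination step of the parallel
associative-scan LQR algorithm coincides with the one produced by one step of
the sequential backward Riccati recursion:
`Ãᵀ(I + PC̃)⁻¹PÃ + P̃ = Q + AᵀPA − Hᵀ G⁻¹ H` where `P̃ = Q − MR⁻¹Mᵀ`,
`Ã = A − BR⁻¹Mᵀ`, `C̃ = BR⁻¹Bᵀ`, `G = R + BᵀPB`, `H = BᵀPA + Mᵀ`. -/
theorem parallel_equals_sequential_riccati {n m : ℕ}
    (R : Matrix (Fin m) (Fin m) ℝ) (hR : R.PosDef)
    (P : Matrix (Fin n) (Fin n) ℝ) (hP : P.PosSemidef)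
    (Q : Matrix (Fin n) (Fin n) ℝ) (hQ : Q.IsSymm)
    (M : Matrix (Fin n) (Fin m) ℝ) (A : Matrix (Fin n) (Fin n) ℝ)
    (B : Matrix (Fin n) (Fin m) ℝ) :
    IsUnit (1 + P * B * R⁻¹ * Bᵀ) ∧ IsUnit (R + Bᵀ * P * B) ∧
    (A - B * R⁻¹ * Mᵀ)ᵀ * (1 + P * B * R⁻¹ * Bᵀ)⁻¹ * P * (A - B * R⁻¹ * Mᵀ)
        + Q - M * R⁻¹ * Mᵀ
      = Q + Aᵀ * P * A
        - (Bᵀ * P * A + Mᵀ)ᵀ * (R + Bᵀ * P * B)⁻¹ * (Bᵀ * P * A + Mᵀ) := by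
  have hPt : Pᵀ = P := by simpa [conjTranspose_eq_transpose_of_trivial] using hP.isHermitian.eq
  have hRt : Rᵀ = R := by simpa [conjTranspose_eq_transpose_of_trivial] using hR.isHermitian.eq
  have hG : IsUnit (R + Bᵀ * P * B) := by
    have h := hP.conjTranspose_mul_mul_same B
    rw [conjTranspose_eq_transpose_of_trivial] at h
    exact (hR.add_posSemidef h).isUnit
  have hRd := (isUnit_iff_isUnit_det _).1 hR.isUnit
  have hGd := (isUnit_iff_isUnit_det _).1 hG
  have hSt : (R⁻¹)ᵀ = R⁻¹ := by rw [transpose_nonsing_inv, hRt]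
  have hSR := nonsing_inv_mul R hRd
  have hRS := mul_nonsing_inv R hRd
  have hKG := nonsing_inv_mul _ hGd
  have hGK := mul_nonsing_inv _ hGd
  generalize (R + Bᵀ * P * B)⁻¹ = K at *
  generalize R⁻¹ = S at *
  -- the two resolvent identities
  have e1 : S * (Bᵀ * (P * (B * K))) = S - K := by
    have h := congrArg (fun X => S * X) hGK
    simp only [Matrix.add_mul, Matrix.mul_add, Matrix.mul_one] at h
    rw [← Matrix.mul_assoc S R K, hSR, Matrix.one_mul] at h
    simp only [Matrix.mul_assoc] at h
    exact eq_sub_of_add_eq' h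
  have e2 : K * (Bᵀ * (P * (B * S))) = S - K := by
    have h := congrArg (fun X => X * S) hKG
    simp only [Matrix.add_mul, Matrix.mul_add, Matrix.one_mul] at h
    rw [Matrix.mul_assoc K R S, hRS, Matrix.mul_one] at h
    simp only [Matrix.mul_assoc] at h
    exact eq_sub_of_add_eq' h
  have e1' : ∀ X : Matrix (Fin m) (Fin n) ℝ,
      S * (Bᵀ * (P * (B * (K * X)))) = S * X - K * X := by
    intro X
    rw [← Matrix.sub_mul, ← e1]; simp only [Matrix.mul_assoc]
  have e2' : ∀ X : Matrix (Fin m) (Fin n) ℝ,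
      K * (Bᵀ * (P * (B * (S * X)))) = S * X - K * X := by
    intro X
    rw [← Matrix.sub_mul, ← e2]; simp only [Matrix.mul_assoc]
  have hinv : (1 + P * B * S * Bᵀ) * (1 - P * B * K * Bᵀ) = 1 := by
    simp only [Matrix.add_mul, Matrix.mul_sub, Matrix.mul_one, Matrix.one_mul,
      Matrix.mul_assoc, e1']
    abel
  refine ⟨(isUnit_iff_isUnit_det _).2 (isUnit_det_of_right_inverse hinv), hG, ?_⟩
  rw [inv_eq_right_inv hinv]
  simp only [transpose_sub, transpose_add, transpose_mul, transpose_transpose, hPt, hSt,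
    Matrix.add_mul, Matrix.mul_add, Matrix.sub_mul, Matrix.mul_sub, Matrix.mul_one,
    Matrix.one_mul, Matrix.mul_assoc, e1', e2']
  abel
end
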